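/- Let P : Δ_{4,n} → [5] be a non-opposite cut (P(e_i) = i for i ∈ [4], and P(x) ∈ Support(x) ∪ {5} for all x), and suppose exactly α(n+1)(n+2) vertices x with x_4 = 0 satisfy P(x) ∈ {1,2,3}, for some α ∈ [0, 1/2]. Then the number of edges xy with x, y ∈ Δ_{4,n}, ‖x−y‖₁ = 2/n, and P(x) ≠ P(y) is at least 3αn(n+1). -/

import Mathlib

open scoped BigOperators

/-- The discretized simplex `Δ_{k,n}`: points with nonnegative coordinates that are
integer multiples of `1/n` summing to `1`. -/
def disimplex (k n : ℕ) : Set (Fin k → ℚ) :=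
  {x | (∀ i, 0 ≤ x i) ∧ (∀ i, ∃ m : ℤ, (n : ℚ) * x i = (m : ℚ)) ∧ ∑ i, x i = 1}

/-- The `i`-th standard unit vector in `ℚ^k`. -/
def stdVec (k : ℕ) (i : Fin k) : Fin k → ℚ := fun j => if j = i then 1 else 0

/-- The hyperedge of `H_{k,n}` indexed by a point `z` of `Δ_{k,n-1}`. -/
def hyperedge (k n : ℕ) (z : Fin k → ℚ) : Set (Fin k → ℚ) :=
  {y | ∃ i : Fin k, y = fun j => (((n : ℚ) - 1) / n) * z j + (1 / n) * stdVec k i j}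

/-- The set of hyperedges of the hypergraph `H_{k,n}`. -/
def hyperedges (k n : ℕ) : Set (Set (Fin k → ℚ)) :=
  (hyperedge k n) '' (disimplex k (n - 1))

/-- The set of cut edges of a labeling `P` of `Δ_{4,n}`: unordered pairs of
vertices at ℓ₁-distance `2/n` receiving different labels. -/
def cutPairs (n : ℕ) (P : (Fin 4 → ℚ) → Fin 5) : Set (Set (Fin 4 → ℚ)) :=
  {p | ∃ x y, x ∈ disimplex 4 n ∧ y ∈ disimplex 4 n ∧ (∑ i, |x i - y i|) = 2 / n ∧
      P x ≠ P y ∧ p = {x, y}}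

theorem sub_single_add_single {ι : Type*} [DecidableEq ι] {x : ι → ℕ} {i : ι} (hx : x i ≠ 0) :
    x - Pi.single i 1 + Pi.single i 1 = x := by
  ext j
  rcases eq_or_ne j i with rfl | hj
  · simp; omega
  · simp [hj]

open Finset in
/-- Local LYM inequality for multisets: if every point obtained from a point of `M` by lowering
a positive coordinate in `t` lies in `N`, then `M` is at most as dense in its level as `N`. -/
theorem card_mul_le_of_lower_mem {ι : Type*} [DecidableEq ι] (t : Finset ι) (m : ℕ)
    (M N : Finset (ι → ℕ)) (hM : ∀ x ∈ M, ∑ i ∈ t, x i = m + 1)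
    (hN : ∀ b ∈ N, ∑ i ∈ t, b i = m)
    (hMN : ∀ i ∈ t, ∀ b, b + Pi.single i 1 ∈ M → b ∈ N) :
    (m + 1) * #M ≤ (m + #t) * #N := by
  classical
  have hi : ∀ i ∈ t, ∑ x ∈ M, x i ≤ ∑ b ∈ N, (b i + 1) := by
    intro i hi
    have hsub : M.filter (fun x => x i ≠ 0) ⊆ N.image (· + Pi.single i 1) := by
      intro x hx
      rw [mem_filter] at hx
      have hadd := sub_single_add_single hx.2
      exact mem_image.2 ⟨x - Pi.single i 1, hMN i hi _ (hadd.symm ▸ hx.1), hadd⟩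
    calc ∑ x ∈ M, x i = ∑ x ∈ M.filter (fun x => x i ≠ 0), x i :=
          (sum_filter_ne_zero (s := M) (f := fun x => x i)).symm
      _ ≤ ∑ x ∈ N.image (· + Pi.single i 1), x i := sum_le_sum_of_subset hsub
      _ = ∑ b ∈ N, (b i + 1) := by
          rw [sum_image fun a _ b _ h => add_right_cancel h]
          simp
  calc (m + 1) * #M = ∑ x ∈ M, ∑ i ∈ t, x i := by
        rw [sum_congr rfl hM]; simp [mul_comm]
    _ = ∑ i ∈ t, ∑ x ∈ M, x i := sum_comm
    _ ≤ ∑ i ∈ t, ∑ b ∈ N, (b i + 1) := sum_le_sum hi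
    _ = ∑ b ∈ N, (∑ i ∈ t, b i + #t) := by
        rw [sum_comm]; simp [sum_add_distrib]
    _ = (m + #t) * #N := by
        rw [sum_congr rfl fun b hb => by rw [hN b hb]]; simp [mul_comm]

/-- The lattice points of `ℕ^4` with coordinate sum `m`. -/
def level (m : ℕ) : Finset (Fin 4 → ℕ) := Finset.piAntidiag Finset.univ m

theorem mem_level {m : ℕ} {a : Fin 4 → ℕ} : a ∈ level m ↔ ∑ i, a i = m := by
  simp [level]

theorem add_single_mem_level {m : ℕ} {b : Fin 4 → ℕ} (hb : b ∈ level m) (i : Fin 4) :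
    b + Pi.single i 1 ∈ level (m + 1) := by
  rw [mem_level] at *
  simp [Finset.sum_add_distrib, hb]

/-- The coordinate that a monochromatic hyperedge of the given color lowers; the fifth color
is treated as the fourth. -/
def colorIndex : Fin 5 → Fin 4 := ![0, 1, 2, 3, 3]

open Finset in
/-- At least as many hyperedges are non-monochromatic as there are hyperedges of the face
`x_4 = 0` that contain a point of that face labeled `1`, `2` or `3`. -/
theorem card_face_le_card_not_mono (m : ℕ) (L : (Fin 4 → ℕ) → Fin 5)
    (hL : ∀ a ∈ level (m + 1), L a = 4 ∨ ∃ i : Fin 4, L a = i.castSucc ∧ 0 < a i) :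
    #{b ∈ level m | b 3 = 0 ∧ ∃ j ≠ 3, L (b + Pi.single j 1) < 3} ≤
      #{b ∈ level m | ¬ ∀ i j, L (b + Pi.single i 1) = L (b + Pi.single j 1)} := by
  set face := {b ∈ level m | b 3 = 0} with hface
  set N := {b ∈ level m | b 3 = 0 ∧ ∃ j ≠ 3, L (b + Pi.single j 1) < 3} with hN
  set mono := {b ∈ level m | ∀ i j, L (b + Pi.single i 1) = L (b + Pi.single j 1)} with hmono
  let color (b : Fin 4 → ℕ) : Fin 4 := colorIndex (L (b + Pi.single 0 1))
  have hpos : ∀ b ∈ mono \ (face \ N), 0 < b (color b) := by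
    intro b hb
    simp only [hmono, hface, hN, mem_sdiff, mem_filter] at hb
    obtain ⟨⟨hbm, hb⟩, hbN⟩ := hb
    rcases hL _ (add_single_mem_level hbm 0) with h | ⟨i, h, -⟩
    · have hc : color b = 3 := by simp [color, h, colorIndex]
      rw [hc, Nat.pos_iff_ne_zero]
      intro h0
      refine hbN ⟨⟨hbm, h0⟩, ?_⟩
      rintro ⟨-, -, j, -, hj⟩
      rw [hb j 0, h] at hj
      exact absurd hj (by decide)
    · have hc : color b = i := by
        simp only [color, h]; fin_cases i <;> rfl
      obtain ⟨j, hj⟩ := exists_ne i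
      rcases hL _ (add_single_mem_level hbm j) with h' | ⟨i', h', hi'⟩
      · rw [hb j 0, h] at h'
        exact absurd h' (Fin.castSucc_lt_last i).ne
      · rw [hb j 0, h] at h'
        obtain rfl := Fin.castSucc_injective _ h'
        rw [hc]
        simpa [hj.symm] using hi'
  have hinj : #(mono \ (face \ N)) ≤ #(level m \ face) := by
    refine card_le_card_of_injOn (fun b => b - Pi.single (color b) 1 + Pi.single 3 1) ?_ ?_
    · intro b hb
      have hp := hpos b hb
      have hbm : b ∈ level m := (mem_filter.1 (mem_sdiff.1 hb).1).1
      have hsum : ∑ i, (b - Pi.single (color b) 1 + Pi.single 3 1 : Fin 4 → ℕ) i = m := by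
        have h1 : ∑ i, (b - Pi.single (color b) 1 + Pi.single (color b) 1 : Fin 4 → ℕ) i = m := by
          rw [sub_single_add_single hp.ne']; exact mem_level.1 hbm
        simpa [sum_add_distrib] using h1
      simp only [hface, coe_sdiff, Set.mem_sdiff, mem_coe, mem_filter, mem_level]
      exact ⟨hsum, fun h => by simpa using h.2⟩
    · intro b hb c hc h
      have hpb := hpos b hb
      have hpc := hpos c hc
      have hmb := (mem_filter.1 (mem_sdiff.1 hb).1).2
      have hmc := (mem_filter.1 (mem_sdiff.1 hc).1).2
      have h' : b - Pi.single (color b) 1 = c - Pi.single (color c) 1 := add_right_cancel h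
      have key : b + Pi.single (color c) 1 = c + Pi.single (color b) 1 := by
        conv_rhs => rw [← sub_single_add_single hpc.ne']
        rw [← h', add_right_comm, sub_single_add_single hpb.ne']
      have hcol : color b = color c := by
        simp only [color]
        rw [hmb 0 (color c), key, hmc (color b) 0]
      rw [hcol] at key
      exact add_right_cancel key
  have h1 : #N + #(face \ N) = #face := by
    rw [add_comm]
    exact card_sdiff_add_card_eq_card fun b hb => by
      simp only [hface, hN, mem_filter] at hb ⊢; exact ⟨hb.1, hb.2.1⟩
  have h2 : #(level m \ face) + #face = #(level m) :=
    card_sdiff_add_card_eq_card (filter_subset _ _)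
  have h3 := card_filter_add_card_filter_not (s := level m)
    (fun b => ∀ i j, L (b + Pi.single i 1) = L (b + Pi.single j 1))
  have h4 := le_card_sdiff (face \ N) mono
  rw [← hmono] at h3
  omega

open Finset in
theorem three_le_card_of_not_const {β : Type*} [DecidableEq β] (f : Fin 4 → β)
    (hf : ¬ ∀ i j, f i = f j) : 3 ≤ #{p : Fin 4 × Fin 4 | p.1 < p.2 ∧ f p.1 ≠ f p.2} := by
  rw [card_filter, Fintype.sum_prod_type]
  simp only [Fin.sum_univ_four, Fin.forall_fin_succ] at *
  simp at *
  grind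

theorem single_pair_inj {b c : Fin 4 → ℕ} {i j k l : Fin 4} (hij : i < j) (hkl : k < l)
    (h : ({b + Pi.single i 1, b + Pi.single j 1} : Set (Fin 4 → ℕ)) =
      {c + Pi.single k 1, c + Pi.single l 1}) : b = c ∧ i = k ∧ j = l := by
  have hinf : ∀ (b : Fin 4 → ℕ) (i j : Fin 4), i ≠ j →
      (b + Pi.single i 1) ⊓ (b + Pi.single j 1) = b := by
    intro b i j hij
    ext x
    simp only [Pi.inf_apply, Pi.add_apply, Pi.single_apply]
    split_ifs <;> simp_all
  have hs : ∀ (b : Fin 4 → ℕ) (i j : Fin 4), b + Pi.single i 1 = b + Pi.single j 1 → i = j := by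
    intro b i j h
    by_contra hne
    simpa [hne] using congrFun (add_left_cancel h) i
  have hbc : b = c := by
    rw [← hinf b i j hij.ne, ← hinf c k l hkl.ne]
    rcases Set.pair_eq_pair_iff.1 h with ⟨h1, h2⟩ | ⟨h1, h2⟩
    · rw [h1, h2]
    · rw [h1, h2, inf_comm]
  subst hbc
  rcases Set.pair_eq_pair_iff.1 h with ⟨h1, h2⟩ | ⟨h1, h2⟩
  · exact ⟨rfl, hs _ _ _ h1, hs _ _ _ h2⟩
  · have := hs _ _ _ h1
    have := hs _ _ _ h2
    omega

/-- The point of `Δ_{4,n}` with numerators `a`. -/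
def latticePoint (n : ℕ) (a : Fin 4 → ℕ) : Fin 4 → ℚ := fun i => (a i : ℚ) / n

theorem latticePoint_injective {n : ℕ} (hn : n ≠ 0) : Function.Injective (latticePoint n) := by
  intro a b h
  ext i
  have hi := congrFun h i
  have hn' : (n : ℚ) ≠ 0 := by exact_mod_cast hn
  simp only [latticePoint, div_left_inj' hn'] at hi
  exact_mod_cast hi

theorem disimplex_eq_image {n : ℕ} (hn : n ≠ 0) :
    disimplex 4 n = latticePoint n '' (level n : Set (Fin 4 → ℕ)) := by
  have hn' : (n : ℚ) ≠ 0 := by exact_mod_cast hn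
  ext x
  constructor
  · rintro ⟨h0, hint, hsum⟩
    choose z hz using hint
    have hz0 : ∀ i, 0 ≤ z i := fun i => by
      have : (0 : ℚ) ≤ z i := hz i ▸ mul_nonneg n.cast_nonneg (h0 i)
      exact_mod_cast this
    have hcast : ∀ i, (((z i).toNat : ℕ) : ℚ) = n * x i := fun i => by
      rw [hz i]; exact_mod_cast Int.toNat_of_nonneg (hz0 i)
    refine ⟨fun i => (z i).toNat, ?_, ?_⟩
    · rw [Finset.mem_coe, mem_level]
      have : ((∑ i, (z i).toNat : ℕ) : ℚ) = n := by
        push_cast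
        rw [Finset.sum_congr rfl fun i _ => hcast i, ← Finset.mul_sum, hsum, mul_one]
      exact_mod_cast this
    · ext i
      simp only [latticePoint, hcast]
      field_simp
  · rintro ⟨a, ha, rfl⟩
    rw [Finset.mem_coe, mem_level] at ha
    refine ⟨fun i => by unfold latticePoint; positivity, fun i => ⟨a i, ?_⟩, ?_⟩
    · simp only [latticePoint, Int.cast_natCast]; field_simp
    · simp only [latticePoint, ← Finset.sum_div]
      rw [div_eq_one_iff_eq hn']
      exact_mod_cast ha

theorem sum_abs_latticePoint_sub {n : ℕ} (b : Fin 4 → ℕ) {i j : Fin 4} (hij : i < j) :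
    ∑ x, |latticePoint n (b + Pi.single i 1) x - latticePoint n (b + Pi.single j 1) x| =
      2 / n := by
  have hterm : ∀ x, |latticePoint n (b + Pi.single i 1) x -
      latticePoint n (b + Pi.single j 1) x| =
        (if x = i then 1 / (n : ℚ) else 0) + (if x = j then 1 / (n : ℚ) else 0) := by
    intro x
    have h : (0 : ℚ) ≤ 1 / n := by positivity
    simp only [latticePoint, Pi.add_apply, Pi.single_apply, ← sub_div]
    split_ifs with h1 h2 h2
    · omega
    · simp
    · simp [abs_div]
    · simp
  simp only [hterm, Finset.sum_add_distrib, Finset.sum_ite_eq', Finset.mem_univ, if_true]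
  ring

theorem cutPairs_finite {n : ℕ} (hn : n ≠ 0) (P : (Fin 4 → ℚ) → Fin 5) :
    (cutPairs n P).Finite := by
  have hfin : (disimplex 4 n).Finite := by
    rw [disimplex_eq_image hn]
    exact (level n).finite_toSet.image _
  refine hfin.finite_subsets.subset ?_
  rintro _ ⟨x, y, hx, hy, -, -, rfl⟩
  exact Set.insert_subset hx (Set.singleton_subset_iff.2 hy)

open Finset in
/-- Every non-monochromatic hyperedge contributes at least three cut edges of its own. -/
theorem three_mul_card_not_mono_le (m : ℕ) (P : (Fin 4 → ℚ) → Fin 5) :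
    3 * #{b ∈ level m | ¬ ∀ i j, P (latticePoint (m + 1) (b + Pi.single i 1)) =
      P (latticePoint (m + 1) (b + Pi.single j 1))} ≤ (cutPairs (m + 1) P).ncard := by
  set Q := {b ∈ level m | ¬ ∀ i j, P (latticePoint (m + 1) (b + Pi.single i 1)) =
      P (latticePoint (m + 1) (b + Pi.single j 1))} with hQ
  let E (b : Fin 4 → ℕ) : Finset (Fin 4 × Fin 4) :=
    {p | p.1 < p.2 ∧ P (latticePoint (m + 1) (b + Pi.single p.1 1)) ≠
      P (latticePoint (m + 1) (b + Pi.single p.2 1))}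
  let edge (q : (_ : Fin 4 → ℕ) × Fin 4 × Fin 4) : Set (Fin 4 → ℚ) :=
    latticePoint (m + 1) '' {q.1 + Pi.single q.2.1 1, q.1 + Pi.single q.2.2 1}
  calc 3 * #Q = ∑ _b ∈ Q, 3 := by simp [mul_comm]
    _ ≤ ∑ b ∈ Q, #(E b) := sum_le_sum fun b hb =>
        three_le_card_of_not_const _ (mem_filter.1 hb).2
    _ = #(Q.sigma E) := (card_sigma _ _).symm
    _ = ((Q.sigma E : Finset _) : Set ((_ : Fin 4 → ℕ) × Fin 4 × Fin 4)).ncard :=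
        (Set.ncard_coe_finset _).symm
    _ ≤ (cutPairs (m + 1) P).ncard := by
        refine Set.ncard_le_ncard_of_injOn edge ?_ ?_ (cutPairs_finite m.succ_ne_zero P)
        · rintro ⟨b, i, j⟩ h
          simp only [mem_coe, mem_sigma, E, hQ, mem_filter, mem_univ, true_and] at h
          obtain ⟨⟨hb, -⟩, hij, hne⟩ := h
          rw [cutPairs, disimplex_eq_image m.succ_ne_zero]
          exact ⟨_, _, Set.mem_image_of_mem _ (add_single_mem_level hb i),
            Set.mem_image_of_mem _ (add_single_mem_level hb j),
            sum_abs_latticePoint_sub b hij, hne, Set.image_pair _ _ _⟩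
        · rintro ⟨b, i, j⟩ h ⟨c, k, l⟩ h' heq
          simp only [mem_coe, mem_sigma, E, mem_filter, mem_univ, true_and] at h h'
          obtain ⟨rfl, rfl, rfl⟩ := single_pair_inj h.2.1 h'.2.1
            ((latticePoint_injective m.succ_ne_zero).image_injective heq)
          rfl

/-- A non-opposite cut of `Δ_{4,n}` with `α(n+1)(n+2)` vertices of the face
`x_4 = 0` labeled `1`, `2` or `3` cuts at least `3αn(n+1)` edges. -/
theorem stmt8 (n : ℕ) (hn : 1 ≤ n) (P : (Fin 4 → ℚ) → Fin 5)
    (hterm : ∀ i : Fin 4, P (stdVec 4 i) = i.castSucc)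
    (hnonopp : ∀ x ∈ disimplex 4 n,
      P x = Fin.last 4 ∨ ∃ i : Fin 4, P x = i.castSucc ∧ 0 < x i)
    (α : ℚ) (hα0 : 0 ≤ α) (hα1 : α ≤ 1 / 2)
    (hcount : ({x ∈ disimplex 4 n | x 3 = 0 ∧
        (P x = 0 ∨ P x = 1 ∨ P x = 2)}.ncard : ℚ) = α * ((n : ℚ) + 1) * ((n : ℚ) + 2)) :
    3 * α * (n : ℚ) * ((n : ℚ) + 1) ≤ ((cutPairs n P).ncard : ℚ) := by
  obtain ⟨m, rfl⟩ : ∃ m, n = m + 1 := ⟨n - 1, by omega⟩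
  let L (a : Fin 4 → ℕ) : Fin 5 := P (latticePoint (m + 1) a)
  have hL : ∀ a ∈ level (m + 1), L a = 4 ∨ ∃ i : Fin 4, L a = i.castSucc ∧ 0 < a i := by
    intro a ha
    have hmem : latticePoint (m + 1) a ∈ disimplex 4 (m + 1) := by
      rw [disimplex_eq_image m.succ_ne_zero]
      exact Set.mem_image_of_mem _ ha
    refine (hnonopp _ hmem).imp id ?_
    rintro ⟨i, hi, hpos⟩
    refine ⟨i, hi, Nat.pos_of_ne_zero fun h => ?_⟩
    simp [latticePoint, h] at hpos
  have hlt : ∀ c : Fin 5, c < 3 ↔ c = 0 ∨ c = 1 ∨ c = 2 := by decide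
  set M : Finset (Fin 4 → ℕ) := {a ∈ level (m + 1) | a 3 = 0 ∧ L a < 3} with hM
  set N : Finset (Fin 4 → ℕ) :=
    {b ∈ level m | b 3 = 0 ∧ ∃ j ≠ 3, L (b + Pi.single j 1) < 3} with hN
  have hset : {x ∈ disimplex 4 (m + 1) | x 3 = 0 ∧ (P x = 0 ∨ P x = 1 ∨ P x = 2)} =
      latticePoint (m + 1) '' (M : Set (Fin 4 → ℕ)) := by
    have h3 : ∀ a, latticePoint (m + 1) a 3 = 0 ↔ a 3 = 0 := fun a => by
      simp [latticePoint, Nat.cast_add_one_ne_zero]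
    rw [disimplex_eq_image m.succ_ne_zero]
    ext x
    constructor
    · rintro ⟨⟨a, ha, rfl⟩, h0, hP⟩
      exact ⟨a, Finset.mem_filter.2 ⟨ha, (h3 a).1 h0, (hlt _).2 hP⟩, rfl⟩
    · rintro ⟨a, ha, rfl⟩
      obtain ⟨ha, h0, hP⟩ := Finset.mem_filter.1 ha
      exact ⟨⟨a, ha, rfl⟩, (h3 a).2 h0, (hlt _).1 hP⟩
  rw [hset, Set.ncard_image_of_injective _ (latticePoint_injective m.succ_ne_zero),
    Set.ncard_coe_finset] at hcount
  have hsum : ∀ a : Fin 4 → ℕ, a 3 = 0 → ∑ i ∈ {0, 1, 2}, a i = ∑ i, a i := by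
    intro a ha
    simp [Fin.sum_univ_four, ha, add_assoc]
  have hlym := card_mul_le_of_lower_mem {0, 1, 2} m M N
    (fun a ha => by
      obtain ⟨ha, h0, -⟩ := Finset.mem_filter.1 ha
      rw [hsum a h0, mem_level.1 ha])
    (fun b hb => by
      obtain ⟨hb, h0, -⟩ := Finset.mem_filter.1 hb
      rw [hsum b h0, mem_level.1 hb])
    (fun i hi b hb => by
      obtain ⟨hb, h0, hP⟩ := Finset.mem_filter.1 hb
      refine Finset.mem_filter.2 ⟨?_, ?_, i, ?_, hP⟩
      · rw [mem_level] at *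
        simpa [Finset.sum_add_distrib] using hb
      · exact (Nat.add_eq_zero_iff.1 h0).1
      · rintro rfl
        exact absurd hi (by decide))
  have hcut := three_mul_card_not_mono_le m P
  have hface := card_face_le_card_not_mono m L hL
  rw [← hN] at hface
  have hle : 3 * (N.card : ℚ) ≤ ((cutPairs (m + 1) P).ncard : ℚ) := by
    exact_mod_cast (Nat.mul_le_mul_left 3 hface).trans hcut
  have hlym' : ((m : ℚ) + 1) * M.card ≤ (m + 3) * N.card := by exact_mod_cast hlym
  refine le_trans ?_ hle
  rw [hcount] at hlym'
  push_cast at hlym' ⊢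
  have hm : (0 : ℚ) < m + 3 := by positivity
  refine le_of_mul_le_mul_left ?_ hm
  linarith
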